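/- arXiv:0805.0584 — 2 statements merged into one kernel-verified Lean document; each statement's English description precedes it below -/
import Mathlib

section
/- Let m, r, c, N ∈ ℕ, let A be an m × r matrix with integer entries satisfying |A(i,j)| ≤ c for all i, j, and let b ∈ ℤ^m satisfy |b(i)| ≤ N for all i. If the system A·x = b has a solution x ∈ ℝ^r, then it has a solution y ∈ ℚ^r with ∑ᵢ |y(i)| ≤ r · r! · (max(c, N) + 1)^r. -/
open Matrix in
/-- A matrix over a field has an invertible square submatrix whose columns extend to a set of
columns of the whole matrix spanning its column space. -/
theorem Matrix.exists_isUnit_submatrix_span_col {K : Type*} [Field K] {m n : Type} [Fintype m]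
    [Finite n] (A : Matrix m n K) :
    ∃ (κ : Type) (_ : Fintype κ) (_ : DecidableEq κ) (f : κ → n) (g : κ → m),
      Function.Injective f ∧
      Submodule.span K (Set.range (A.submatrix id f).col) = Submodule.span K (Set.range A.col) ∧
      IsUnit (A.submatrix g f) := by
  classical
  obtain ⟨κ, f, hf, hspan, hli⟩ := exists_linearIndependent' K A.col
  have : Finite κ := Finite.of_injective f hf
  cases nonempty_fintype κ
  set B : Matrix m κ K := A.submatrix id f
  obtain ⟨κ', g, hg, hspan', hli'⟩ := exists_linearIndependent' K B.row
  have : Finite κ' := Finite.of_injective g hg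
  cases nonempty_fintype κ'
  have hcard : Fintype.card κ = Fintype.card κ' := by
    have hcol : B.rank = Fintype.card κ := by
      rw [B.rank_eq_finrank_span_cols]
      exact finrank_span_eq_card hli
    rw [← hcol, B.rank_eq_finrank_span_row, ← hspan', finrank_span_eq_card hli']
  let e : κ ≃ κ' := Fintype.equivOfCardEq hcard
  refine ⟨κ, inferInstance, inferInstance, f, g ∘ e, hf, hspan, ?_⟩
  rw [← linearIndependent_rows_iff_isUnit]
  exact hli'.comp e e.injective

open Matrix in
/-- A real-solvable integer system is solved, up to a nonzero integer factor `C.det`, by Cramer's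
rule applied to some square submatrix `C`. -/
theorem Matrix.exists_submatrix_mulVec_cramer_eq {m n : Type} [Fintype m] [Fintype n]
    (A : Matrix m n ℤ) (b : m → ℤ)
    (hx : ∃ x : n → ℝ, (A.map (Int.cast : ℤ → ℝ)) *ᵥ x = fun i => (b i : ℝ)) :
    ∃ (κ : Type) (_ : Fintype κ) (_ : DecidableEq κ) (f : κ → n) (g : κ → m),
      Function.Injective f ∧ (A.submatrix g f).det ≠ 0 ∧
      A.submatrix id f *ᵥ cramer (A.submatrix g f) (b ∘ g) = (A.submatrix g f).det • b := by
  obtain ⟨x, hx⟩ := hx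
  obtain ⟨κ, _, _, f, g, hf, hspan, hunit⟩ :=
    (A.map (Int.cast : ℤ → ℝ)).exists_isUnit_submatrix_span_col
  set C := A.submatrix g f
  have hmap : (A.map (Int.cast : ℤ → ℝ)).submatrix g f = (Int.castRingHom ℝ).mapMatrix C := rfl
  obtain ⟨w, hw⟩ : ∃ w, (A.map (Int.cast : ℤ → ℝ)).submatrix id f *ᵥ w = fun i => (b i : ℝ) := by
    have hmem : (fun i => (b i : ℝ)) ∈
        LinearMap.range (A.map (Int.cast : ℤ → ℝ)).mulVecLin := ⟨x, hx⟩
    rw [Matrix.range_mulVecLin, ← hspan, ← Matrix.range_mulVecLin] at hmem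
    exact hmem
  have hCw : (Int.castRingHom ℝ).mapMatrix C *ᵥ w = fun k => (b (g k) : ℝ) := by
    ext k
    exact congrFun hw (g k)
  have hcramer (k : κ) : (cramer C (b ∘ g) k : ℝ) = C.det * w k := by
    have h : cramer ((Int.castRingHom ℝ).mapMatrix C) (fun k => (b (g k) : ℝ)) =
        ((Int.castRingHom ℝ).mapMatrix C).det • w := by
      rw [← hCw, cramer_eq_adjugate_mulVec, mulVec_mulVec, adjugate_mul, smul_mulVec, one_mulVec]
    have h' := congrFun h k
    rw [← RingHom.map_det] at h'
    rw [cramer_eq_adjugate_mulVec, ← RingHom.map_adjugate] at h'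
    rw [cramer_eq_adjugate_mulVec]
    simpa [mulVec, dotProduct] using h'
  refine ⟨κ, inferInstance, inferInstance, f, g, hf, ?_, ?_⟩
  · rw [hmap, isUnit_iff_isUnit_det, ← RingHom.map_det] at hunit
    simpa using hunit.ne_zero
  · ext i
    have hwi : ∑ k, (A i (f k) : ℝ) * w k = b i := congrFun hw i
    have : (∑ k, (A i (f k) : ℝ) * (cramer C (b ∘ g) k : ℝ)) = C.det * b i := by
      rw [← hwi, Finset.mul_sum]
      refine Finset.sum_congr rfl fun k _ => ?_
      rw [hcramer]
      ring
    change ∑ k, A i (f k) * cramer C (b ∘ g) k = C.det * b i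
    exact_mod_cast this

open Matrix in
theorem Matrix.abs_cramer_le {n : Type*} [Fintype n] [DecidableEq n] {A : Matrix n n ℤ}
    {b : n → ℤ} {M : ℤ} (hA : ∀ i j, |A i j| ≤ M) (hb : ∀ i, |b i| ≤ M) (i : n) :
    |cramer A b i| ≤ (Fintype.card n).factorial * M ^ Fintype.card n := by
  rw [cramer_apply, ← nsmul_eq_mul]
  refine det_le (abv := AbsoluteValue.abs) fun k l => ?_
  rw [AbsoluteValue.abs_apply, updateCol_apply]
  split_ifs
  exacts [hb k, hA k l]

theorem rat_solution_small_l1_of_real_solution (m r c N : ℕ)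
    (A : Matrix (Fin m) (Fin r) ℤ) (b : Fin m → ℤ)
    (hA : ∀ i j, |A i j| ≤ (c : ℤ)) (hb : ∀ i, |b i| ≤ (N : ℤ))
    (hx : ∃ x : Fin r → ℝ, (A.map (Int.cast : ℤ → ℝ)).mulVec x = fun i => (b i : ℝ)) :
    ∃ y : Fin r → ℚ, (A.map (Int.cast : ℤ → ℚ)).mulVec y = (fun i => (b i : ℚ)) ∧
      ∑ i, |y i| ≤ ((r * r.factorial * (max c N + 1) ^ r : ℕ) : ℚ) := by
  obtain ⟨κ, _, _, f, g, hf, hdet, hsol⟩ := A.exists_submatrix_mulVec_cramer_eq b hx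
  set C := A.submatrix g f
  set v := Matrix.cramer C (b ∘ g)
  set M : ℕ := max c N + 1
  have hcard : Fintype.card κ ≤ r := by simpa using Fintype.card_le_of_injective f hf
  have hdetQ : (C.det : ℚ) ≠ 0 := by exact_mod_cast hdet
  have hvle (k : κ) : |(v k : ℚ)| ≤ ((r.factorial * M ^ r : ℕ) : ℚ) := by
    have h1 : |v k| ≤ (Fintype.card κ).factorial * (M : ℤ) ^ Fintype.card κ := by
      refine Matrix.abs_cramer_le (fun i j => (hA _ _).trans ?_) (fun i => (hb _).trans ?_) k
      · exact_mod_cast (le_max_left c N).trans (Nat.le_succ _)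
      · exact_mod_cast (le_max_right c N).trans (Nat.le_succ _)
    have h2 : (Fintype.card κ).factorial * M ^ Fintype.card κ ≤ r.factorial * M ^ r :=
      Nat.mul_le_mul (Nat.factorial_le hcard) (Nat.pow_le_pow_right (Nat.succ_pos _) hcard)
    have h3 : |v k| ≤ ((r.factorial * M ^ r : ℕ) : ℤ) := h1.trans (by exact_mod_cast h2)
    exact_mod_cast h3
  have hzle (k : κ) : |(v k : ℚ) / C.det| ≤ ((r.factorial * M ^ r : ℕ) : ℚ) := by
    have hone : (1 : ℚ) ≤ |(C.det : ℚ)| := by exact_mod_cast Int.one_le_abs hdet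
    rw [abs_div]
    exact (div_le_self (abs_nonneg _) hone).trans (hvle k)
  refine ⟨Function.extend f (fun k => (v k : ℚ) / C.det) 0, ?_, ?_⟩
  · ext i
    have hi : ∑ k, (A i (f k) : ℚ) * v k = C.det * b i := by
      have h : ∑ k, A i (f k) * v k = C.det * b i := congrFun hsol i
      exact_mod_cast h
    calc ∑ j, (A i j : ℚ) * Function.extend f (fun k => (v k : ℚ) / C.det) 0 j
        = ∑ k, (A i (f k) : ℚ) * (v k / C.det) := by
          refine (Finset.sum_of_injOn f hf.injOn (by simp) (fun j _ hj => ?_) fun k _ => ?_).symm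
          · rw [Function.extend_apply' _ _ _ (by simpa using hj)]
            simp
          · rw [hf.extend_apply]
      _ = b i := by
          simp_rw [← mul_div_assoc]
          rw [← Finset.sum_div, hi, mul_div_cancel_left₀ _ hdetQ]
  · have hle (j : Fin r) : |Function.extend f (fun k => (v k : ℚ) / C.det) 0 j| ≤
        ((r.factorial * M ^ r : ℕ) : ℚ) := by
      by_cases hj : ∃ k, f k = j
      · obtain ⟨k, rfl⟩ := hj
        rw [hf.extend_apply]
        exact hzle k
      · rw [Function.extend_apply' _ _ _ hj, Pi.zero_apply, abs_zero]
        positivity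
    calc _ ≤ ∑ _j : Fin r, ((r.factorial * M ^ r : ℕ) : ℚ) := Finset.sum_le_sum fun j _ => hle j
      _ = _ := by simp [mul_assoc]
end

section
/- There exists a computable function F : ℕ × ℕ × ℕ → ℕ with the following property: for all m, r, c, N ∈ ℕ, every m × r integer matrix A with |A(i,j)| ≤ c and every b ∈ ℤ^m with |b(i)| ≤ N, if the system A·x = b has a solution x ∈ ℝ^r, then it has a solution x ∈ ℝ^r with ∑ᵢ |x(i)| ≤ F(r, c, N). -/
/-- Eliminating one variable at a time bounds the `ℓ¹`-norm of some solution of an integer system. -/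
theorem exists_solution_l1_le (r : ℕ) : ∀ (m c N : ℕ) (A : Matrix (Fin m) (Fin r) ℤ)
    (b : Fin m → ℤ), (∀ i j, |A i j| ≤ (c : ℤ)) → (∀ i, |b i| ≤ (N : ℤ)) →
    (∃ x : Fin r → ℝ, ∀ i, ∑ j, (A i j : ℝ) * x j = b i) →
    ∃ x : Fin r → ℝ, (∀ i, ∑ j, (A i j : ℝ) * x j = b i) ∧
      ∑ j, |x j| ≤ (N * (2 * (c + 1)) ^ 4 ^ r : ℝ) := by
  induction r with
  | zero =>
    rintro m c N A b - - ⟨x, hx⟩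
    refine ⟨x, hx, ?_⟩
    simp only [Finset.univ_eq_empty, Finset.sum_empty]
    positivity
  | succ r ih =>
    rintro m c N A b hA hb ⟨x, hx⟩
    have hD : (1 : ℝ) ≤ 2 * (c + 1) := by linarith [(Nat.cast_nonneg c : (0 : ℝ) ≤ c)]
    simp only [Fin.sum_univ_succ] at hx ⊢
    by_cases h0 : ∀ i, A i 0 = 0
    · obtain ⟨y, hy, hyb⟩ := ih m c N (fun i j => A i j.succ) b (fun i j => hA i j.succ) hb
        ⟨fun j => x j.succ, fun i => by simpa [h0] using hx i⟩
      refine ⟨Fin.cons 0 y, fun i => by simpa [h0] using hy i, ?_⟩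
      simp only [Fin.cons_zero, Fin.cons_succ, abs_zero, zero_add]
      refine hyb.trans (mul_le_mul_of_nonneg_left ?_ (Nat.cast_nonneg N))
      exact pow_le_pow_right₀ hD (Nat.pow_le_pow_right (by norm_num) r.le_succ)
    · push Not at h0
      obtain ⟨k, hk⟩ := h0
      have hkR : (A k 0 : ℝ) ≠ 0 := by exact_mod_cast hk
      have hk1 : (1 : ℝ) ≤ |(A k 0 : ℝ)| := by exact_mod_cast Int.one_le_abs hk
      have split (i : Fin m) (z : Fin r → ℝ) :
          ∑ j, ((A k 0 * A i j.succ - A i 0 * A k j.succ : ℤ) : ℝ) * z j =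
            A k 0 * ∑ j : Fin r, (A i j.succ : ℝ) * z j
              - A i 0 * ∑ j : Fin r, (A k j.succ : ℝ) * z j := by
        rw [Finset.mul_sum, Finset.mul_sum, ← Finset.sum_sub_distrib]
        refine Finset.sum_congr rfl fun j _ => ?_
        push_cast
        ring
      have bound {u v w z d : ℤ} (hu : |u| ≤ c) (hv : |v| ≤ d) (hw : |w| ≤ c) (hz : |z| ≤ d) :
          |u * v - w * z| ≤ 2 * c * d := by
        have h1 : |u * v| ≤ c * d := by rw [abs_mul]; gcongr
        have h2 : |w * z| ≤ c * d := by rw [abs_mul]; gcongr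
        linarith [abs_sub (u * v) (w * z)]
      obtain ⟨y, hy, hyb⟩ := ih m (2 * c * c) (2 * c * N)
        (fun i j => A k 0 * A i j.succ - A i 0 * A k j.succ)
        (fun i => A k 0 * b i - A i 0 * b k)
        (fun i j => by push_cast; exact bound (hA _ _) (hA _ _) (hA _ _) (hA _ _))
        (fun i => by push_cast; exact bound (hA _ _) (hb _) (hA _ _) (hb _))
        ⟨fun j => x j.succ, fun i => by
          rw [split]
          push_cast
          linear_combination (A k 0 : ℝ) * hx i - (A i 0 : ℝ) * hx k⟩
      simp only [split] at hy
      push_cast at hy hyb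
      refine ⟨Fin.cons ((b k - ∑ j : Fin r, (A k j.succ : ℝ) * y j) / A k 0) y, fun i => ?_, ?_⟩
      · simp only [Fin.cons_zero, Fin.cons_succ]
        field_simp
        linear_combination hy i
      · simp only [Fin.cons_zero, Fin.cons_succ]
        set S := ∑ j, |y j|
        have hrow : |∑ j : Fin r, (A k j.succ : ℝ) * y j| ≤ c * S := by
          rw [Finset.mul_sum]
          refine (Finset.abs_sum_le_sum_abs _ _).trans (Finset.sum_le_sum fun j _ => ?_)
          rw [abs_mul]
          gcongr
          exact_mod_cast hA k j.succ
        have hbk : |(b k : ℝ)| ≤ N := by exact_mod_cast hb k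
        have hfirst : |(b k - ∑ j : Fin r, (A k j.succ : ℝ) * y j) / A k 0| ≤ N + c * S := by
          rw [abs_div]
          refine (div_le_self (abs_nonneg _) hk1).trans ?_
          linarith [abs_sub (b k : ℝ) (∑ j : Fin r, (A k j.succ : ℝ) * y j)]
        set D : ℝ := 2 * (c + 1) with hDdef
        have hc : (0 : ℝ) ≤ c := Nat.cast_nonneg c
        have hN : (0 : ℝ) ≤ N := Nat.cast_nonneg N
        have hpow : (2 * (2 * (c : ℝ) * c + 1)) ^ 4 ^ r ≤ D ^ (2 * 4 ^ r) := by
          rw [pow_mul]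
          gcongr
          rw [hDdef]
          nlinarith
        have hone : 1 ≤ D ^ (2 * 4 ^ r) := one_le_pow₀ hD
        have hexp : D ^ (2 + 2 * 4 ^ r) ≤ D ^ 4 ^ (r + 1) := by
          refine pow_le_pow_right₀ hD ?_
          have := Nat.one_le_pow r 4 (by norm_num)
          rw [pow_succ]
          omega
        have hS : S ≤ 2 * c * N * D ^ (2 * 4 ^ r) := hyb.trans (by gcongr)
        calc _ ≤ N + (c + 1) * S := by linarith
          _ ≤ N * D ^ (2 * 4 ^ r) + (c + 1) * (2 * c * N * D ^ (2 * 4 ^ r)) := by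
              gcongr
              exact le_mul_of_one_le_right hN hone
          _ = N * ((1 + (c + 1) * (2 * c)) * D ^ (2 * 4 ^ r)) := by ring
          _ ≤ N * (D ^ 2 * D ^ (2 * 4 ^ r)) := by
              gcongr
              rw [hDdef]
              nlinarith
          _ ≤ N * D ^ 4 ^ (r + 1) := by
              rw [← pow_add]
              gcongr

theorem Primrec.nat_pow : Primrec₂ ((· ^ ·) : ℕ → ℕ → ℕ) :=
  Primrec₂.unpaired'.1 Nat.Primrec.pow

theorem exists_computable_l1_bound :
    ∃ F : ℕ × ℕ × ℕ → ℕ, Computable F ∧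
      ∀ (m r c N : ℕ) (A : Matrix (Fin m) (Fin r) ℤ) (b : Fin m → ℤ),
        (∀ i j, |A i j| ≤ (c : ℤ)) → (∀ i, |b i| ≤ (N : ℤ)) →
        (∃ x : Fin r → ℝ, (A.map (Int.cast : ℤ → ℝ)).mulVec x = fun i => (b i : ℝ)) →
        ∃ x : Fin r → ℝ, (A.map (Int.cast : ℤ → ℝ)).mulVec x = (fun i => (b i : ℝ)) ∧
          ∑ i, |x i| ≤ (F (r, c, N) : ℝ) := by
  refine ⟨fun p => p.2.2 * (2 * (p.2.1 + 1)) ^ 4 ^ p.1, Primrec.to_comp ?_, ?_⟩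
  · have hc : Primrec fun p : ℕ × ℕ × ℕ => p.2.1 := Primrec.fst.comp Primrec.snd
    have hN : Primrec fun p : ℕ × ℕ × ℕ => p.2.2 := Primrec.snd.comp Primrec.snd
    exact Primrec.nat_mul.comp hN (Primrec.nat_pow.comp
      (Primrec.nat_mul.comp (Primrec.const 2) (Primrec.succ.comp hc))
      (Primrec.nat_pow.comp (Primrec.const 4) Primrec.fst))
  · intro m r c N A b hA hb hx
    have hiff (x : Fin r → ℝ) : (A.map (Int.cast : ℤ → ℝ)).mulVec x = (fun i => (b i : ℝ)) ↔
        ∀ i, ∑ j, (A i j : ℝ) * x j = b i := by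
      simp [funext_iff, Matrix.mulVec, dotProduct]
    simp only [hiff] at hx ⊢
    push_cast
    exact exists_solution_l1_le r m c N A b hA hb hx
end
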